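/- Let (R,m) be a complete Noetherian local domain of Krull dimension 1. Then R has the linear approximation property: every finite system of polynomials f = (f₁,…,f_r) in R[X₁,…,X_N] admits an Artin bound that is bounded above by a linear function of n. -/

import Mathlib

open MvPolynomial IsLocalRing

/-- `β` is an Artin bound for the system `f` with respect to the maximal ideal `m`. -/
def IsArtinBound {R : Type*} [CommRing R] (I : Ideal R) {N r : ℕ}
    (f : Fin r → MvPolynomial (Fin N) R) (β : ℕ → ℕ) : Prop :=
  ∀ n : ℕ, ∀ a : Fin N → R, (∀ i, eval a (f i) ∈ I ^ β n) →
    ∃ b : Fin N → R, (∀ i, eval b (f i) = 0) ∧ ∀ j, a j - b j ∈ I ^ n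

set_option linter.unusedSectionVars false

/-- Complete discrete valuation ring with uniformizer `ϖ`, in elementary terms. -/
structure CDV (A : Type*) [CommRing A] (ϖ : A) : Prop where
  ne : ϖ ≠ 0
  nu : ¬ IsUnit ϖ
  h2 : ∀ y, ϖ ∣ y ∨ IsUnit y
  h0 : ∀ x, (∀ n, ϖ ^ n ∣ x) → x = 0
  hc : ∀ u : ℕ → A, (∀ n, ϖ ^ n ∣ u (n + 1) - u n) → ∃ L, ∀ n, ϖ ^ n ∣ L - u n

section CDVlemmas

variable {A : Type*} [CommRing A] [IsDomain A] {ϖ : A}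

lemma CDV.h1 (h : CDV A ϖ) (s : ℕ) : ∀ x, ¬ ϖ ^ s ∣ x → x ∣ ϖ ^ s := by
  induction s with
  | zero => intro x hx; simp at hx
  | succ s ih =>
    intro x hx
    rcases h.h2 x with ⟨y, rfl⟩ | hu
    · rw [pow_succ', mul_dvd_mul_iff_left h.ne] at hx
      rw [pow_succ']
      exact mul_dvd_mul_left _ (ih y hx)
    · exact hu.dvd

lemma CDV.mul (h : CDV A ϖ) {s t : ℕ} {x y : A} (hxy : ϖ ^ (s + t) ∣ x * y) :
    ϖ ^ s ∣ x ∨ ϖ ^ t ∣ y := by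
  by_contra! hcon
  obtain ⟨z, hz⟩ := h.h1 s x hcon.1
  apply hcon.2
  have : ϖ ^ s * ϖ ^ t ∣ ϖ ^ s * y := by
    rw [← pow_add, hz]
    exact hxy.trans ⟨z, by ring⟩
  exact (mul_dvd_mul_iff_left (pow_ne_zero _ h.ne)).1 this

lemma CDV.pow_dvd (h : CDV A ϖ) {s t : ℕ} (hst : ϖ ^ s ∣ ϖ ^ t) : s ≤ t := by
  by_contra! hlt
  obtain ⟨k, rfl⟩ := Nat.exists_eq_add_of_lt hlt
  have h1 : ϖ ^ t * ϖ ^ (k + 1) ∣ ϖ ^ t * 1 := by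
    rw [← pow_add, mul_one]; exact hst
  have := (mul_dvd_mul_iff_left (pow_ne_zero _ h.ne)).1 h1
  exact h.nu (isUnit_of_dvd_one ((dvd_pow_self ϖ (Nat.succ_ne_zero k)).trans this))

lemma CDV.fix (h : CDV A ϖ) (c : A) (Q : Polynomial A) : ∃ w, w = c + ϖ * Q.eval w := by
  let u : ℕ → A := fun n => Nat.rec 0 (fun _ w => c + ϖ * Q.eval w) n
  have hu : ∀ n, u (n + 1) = c + ϖ * Q.eval (u n) := fun n => rfl
  have hcau : ∀ n, ϖ ^ n ∣ u (n + 1) - u n := by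
    intro n
    induction n with
    | zero => simp
    | succ n ih =>
      rw [hu (n + 1)]
      nth_rewrite 2 [hu n]
      have : c + ϖ * Q.eval (u (n + 1)) - (c + ϖ * Q.eval (u n)) =
          ϖ * (Q.eval (u (n + 1)) - Q.eval (u n)) := by ring
      rw [this, pow_succ']
      exact mul_dvd_mul_left _ (ih.trans (Polynomial.sub_dvd_eval_sub _ _ _))
  obtain ⟨L, hL⟩ := h.hc u hcau
  refine ⟨L, sub_eq_zero.1 (h.h0 _ fun n => ?_)⟩
  have e : L - (c + ϖ * Q.eval L) = (L - u (n + 1)) - ϖ * (Q.eval L - Q.eval (u n)) := by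
    rw [hu]; ring
  rw [e]
  refine dvd_sub ((pow_dvd_pow _ n.le_succ).trans (hL _)) (Dvd.dvd.mul_left ?_ _)
  exact (hL n).trans (Polynomial.sub_dvd_eval_sub _ _ _)

lemma CDV.hensel (h : CDV A ϖ) (f : Polynomial A) (τ : A) (s n : ℕ)
    (hd : ¬ ϖ ^ s ∣ f.derivative.eval τ) (hf : ϖ ^ (2 * s + n + 1) ∣ f.eval τ) :
    ∃ τ', f.eval τ' = 0 ∧ ϖ ^ n ∣ τ' - τ := by
  obtain ⟨z, hz⟩ := h.h1 s _ hd
  obtain ⟨k, hk⟩ := hf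
  set δ := f.derivative.eval τ with hδ
  set g := (Polynomial.taylor τ f).divX.divX with hg
  have hexp : ∀ ε, f.eval (τ + ε) = f.eval τ + δ * ε + ε ^ 2 * g.eval ε := by
    intro ε
    have e1 : f.eval (τ + ε) = (Polynomial.taylor τ f).eval ε := by
      rw [Polynomial.taylor_eval, add_comm]
    have e2 := Polynomial.divX_mul_X_add (Polynomial.taylor τ f)
    have e3 := Polynomial.divX_mul_X_add (Polynomial.taylor τ f).divX
    rw [e1, ← e2, ← e3, ← hg]
    simp only [Polynomial.coeff_divX, Polynomial.taylor_coeff_zero, Polynomial.eval_add,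
      Polynomial.eval_mul, Polynomial.eval_X, Polynomial.eval_C, zero_add,
      Polynomial.taylor_coeff_one, ← hδ]
    ring
  obtain ⟨w, hw⟩ := h.fix (-(z ^ 2 * k))
    (-(Polynomial.C (ϖ ^ n) * Polynomial.X ^ 2 *
      g.comp (Polynomial.C (δ * ϖ ^ (n + 1)) * Polynomial.X)))
  simp only [Polynomial.eval_neg, Polynomial.eval_mul, Polynomial.eval_C, Polynomial.eval_pow,
    Polynomial.eval_X, Polynomial.eval_comp] at hw
  refine ⟨τ + δ * ϖ ^ (n + 1) * w, ?_, ?_⟩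
  · rw [hexp, hk]
    have : ϖ ^ (2 * s + n + 1) = (δ * z) ^ 2 * ϖ ^ (n + 1) := by
      rw [← hz]; ring
    rw [this]
    set gg := g.eval (δ * ϖ ^ (n + 1) * w)
    have hw' : z ^ 2 * k + w + ϖ ^ (n + 1) * w ^ 2 * gg = 0 := by
      rw [pow_succ]; linear_combination hw
    linear_combination δ ^ 2 * ϖ ^ (n + 1) * hw'
  · rw [add_sub_cancel_left]
    exact ⟨δ * ϖ * w, by ring⟩

end CDVlemmas

section LiftSep

variable {A : Type*} [CommRing A] [IsDomain A] {ϖ : A}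

lemma lift_sep (h : CDV A ϖ) {N : ℕ} (P : Ideal (MvPolynomial (Fin N) A)) (s : Set (Fin N))
    (ρ : MvPolynomial s A →+* MvPolynomial (Fin N) A) (T : MvPolynomial (Fin N) A)
    (hρ : ∀ a : Fin N → A, ∀ q, eval a (ρ q) = eval (fun i : s => a i) q)
    (hρC : ∀ r, ρ (C r) = C r)
    (f : Polynomial (MvPolynomial s A)) (D : MvPolynomial s A)
    (G : Fin N → Polynomial (MvPolynomial s A))
    (hf : f.eval₂ ρ T ∈ P)
    (hker : ∀ Q : Polynomial (MvPolynomial s A), Q.eval₂ ρ T ∈ P → f ∣ Q)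
    (hG : ∀ j, ρ D * X j - (G j).eval₂ ρ T ∈ P)
    (a : Fin N → A) (k n : ℕ)
    (hnd : ¬ ϖ ^ k ∣ eval a (ρ D * f.derivative.eval₂ ρ T))
    (hP : ∀ q ∈ P, ϖ ^ (3 * k + n + 1) ∣ eval a q) :
    ∃ b : Fin N → A, (∀ q ∈ P, eval b q = 0) ∧ ∀ j, ϖ ^ n ∣ a j - b j := by
  set α : s → A := fun i => a i with hα
  set ev : Polynomial (MvPolynomial s A) →+* Polynomial A := Polynomial.mapRingHom (eval α) with hev
  set τ := eval a T with hτ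
  have hcomm : ∀ Q : Polynomial (MvPolynomial s A), eval a (Q.eval₂ ρ T) = (ev Q).eval τ := by
    intro Q
    rw [Polynomial.hom_eval₂, hev, Polynomial.coe_mapRingHom, Polynomial.eval_map]
    congr 1
    exact RingHom.ext fun q => by simp [hρ, hα]
  have hD : ¬ ϖ ^ k ∣ eval α D := by
    intro hh; apply hnd; rw [map_mul, hρ]; exact hh.mul_right _
  have hfd : ¬ ϖ ^ k ∣ (ev f).derivative.eval τ := by
    intro hh; apply hnd; rw [map_mul, hcomm]
    have : ev (Polynomial.derivative f) = Polynomial.derivative (ev f) := by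
      simp [hev, Polynomial.derivative_map]
    rw [this]; exact hh.mul_left _
  obtain ⟨τ', hτ0, hτ1⟩ := h.hensel (ev f) τ k (k + n) hfd (by
    have := hP _ hf
    rw [hcomm] at this
    convert this using 2; ring)
  obtain ⟨z, hz⟩ := h.h1 k _ hD
  have hD0 : eval α D ≠ 0 := by
    intro h0; exact hD (h0 ▸ dvd_zero _)
  have hb : ∀ j, ∃ b, eval α D * b = (ev (G j)).eval τ' ∧ ϖ ^ n ∣ a j - b := by
    intro j
    have e1 := (pow_dvd_pow ϖ (show k + n ≤ 3 * k + n + 1 by omega)).trans (hP _ (hG j))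
    rw [map_sub, map_mul, hρ, hcomm, eval_X] at e1
    have e2 := hτ1.trans (Polynomial.sub_dvd_eval_sub τ' τ (ev (G j)))
    obtain ⟨w, hw⟩ := dvd_sub e2 e1
    refine ⟨a j + ϖ ^ n * z * w, ?_, ⟨- (z * w), by ring⟩⟩
    rw [pow_add, hz] at hw
    linear_combination -hw
  choose b hb1 hb2 using hb
  refine ⟨b, fun q hq => ?_, hb2⟩
  have key : ∀ q : MvPolynomial (Fin N) A, ∃ (m : ℕ) (Q : Polynomial (MvPolynomial s A)),
      ρ D ^ m * q - Q.eval₂ ρ T ∈ P ∧ (ev Q).eval τ' = eval α D ^ m * eval b q := by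
    intro q
    induction q using MvPolynomial.induction_on with
    | C r => exact ⟨0, Polynomial.C (C r), by simp [hρC], by simp [hev]⟩
    | add p q hp hq =>
      obtain ⟨m1, Q1, h1, h1'⟩ := hp
      obtain ⟨m2, Q2, h2, h2'⟩ := hq
      refine ⟨m1 + m2, Polynomial.C (D ^ m2) * Q1 + Polynomial.C (D ^ m1) * Q2, ?_, ?_⟩
      · have := P.add_mem (P.mul_mem_left (ρ D ^ m2) h1) (P.mul_mem_left (ρ D ^ m1) h2)
        convert this using 1
        simp only [Polynomial.eval₂_add, Polynomial.eval₂_mul, Polynomial.eval₂_C, Polynomial.eval₂_pow, map_pow]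
        ring
      · simp only [map_add, map_mul, Polynomial.eval_add, Polynomial.eval_mul, h1', h2']
        simp only [hev, Polynomial.coe_mapRingHom, Polynomial.map_C, Polynomial.eval_C,
          Polynomial.eval_pow, map_pow]
        ring
    | mul_X p j hp =>
      obtain ⟨m1, Q1, h1, h1'⟩ := hp
      refine ⟨m1 + 1, Q1 * G j, ?_, ?_⟩
      · have := P.add_mem (P.mul_mem_left (ρ D * X j) h1)
          (P.mul_mem_left (Q1.eval₂ ρ T) (hG j))
        convert this using 1
        simp only [Polynomial.eval₂_mul]
        ring
      · simp only [map_mul, Polynomial.eval_mul, h1', ← hb1, eval_X]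
        ring
  obtain ⟨m, Q, hQ1, hQ2⟩ := key q
  have hQP : Q.eval₂ ρ T ∈ P := by
    have := P.sub_mem (P.mul_mem_left (ρ D ^ m) hq) hQ1
    simpa using this
  obtain ⟨v, rfl⟩ := hker Q hQP
  rw [map_mul, Polynomial.eval_mul, hτ0, zero_mul] at hQ2
  exact (mul_eq_zero.1 hQ2.symm).resolve_left (pow_ne_zero _ hD0)

end LiftSep

section Insep

variable {A : Type*} [CommRing A] [IsDomain A] {ϖ : A}

lemma insep_lin (h : CDV A ϖ) (p : ℕ) {ι : Type*} (β : ι → A) (t : Finset ι) (N0 : ℕ)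
    (hN : ∀ y : ι → A, ϖ ^ N0 ∣ ∑ j ∈ t, β j * y j ^ p → ∀ j ∈ t, ϖ ∣ y j) (n : ℕ) :
    ∀ y : ι → A, ϖ ^ (N0 + p * n) ∣ ∑ j ∈ t, β j * y j ^ p → ∀ j ∈ t, ϖ ^ n ∣ y j := by
  induction n with
  | zero => intro y _ j _; simp
  | succ n ih =>
    intro y hy j hj
    have h1 := hN y ((pow_dvd_pow _ (by omega)).trans hy)
    have : ∀ j, ∃ z, j ∈ t → y j = ϖ * z := by
      intro j
      by_cases hj : j ∈ t
      · obtain ⟨z, hz⟩ := h1 j hj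
        exact ⟨z, fun _ => hz⟩
      · exact ⟨0, fun h => absurd h hj⟩
    choose z hz using this
    have e : ∑ j ∈ t, β j * y j ^ p = ϖ ^ p * ∑ j ∈ t, β j * z j ^ p := by
      rw [Finset.mul_sum]
      refine Finset.sum_congr rfl fun j hj => ?_
      rw [hz j hj]; ring
    rw [e, show N0 + p * (n + 1) = p + (N0 + p * n) by ring, pow_add,
      mul_dvd_mul_iff_left (pow_ne_zero _ h.ne)] at hy
    rw [hz j hj, pow_succ']
    exact mul_dvd_mul_left _ (ih z hy j hj)

lemma insep_one (h : CDV A ϖ) (p : ℕ) [Fact p.Prime] [CharP A p] {ι : Type*} (β : ι → A)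
    (t : Finset ι) :
    (∀ y : ι → A, ∑ j ∈ t, β j * y j ^ p = 0 → ∀ j ∈ t, y j = 0) →
    ∃ N0, ∀ y : ι → A, ϖ ^ N0 ∣ ∑ j ∈ t, β j * y j ^ p → ∀ j ∈ t, ϖ ∣ y j := by
  classical
  have hp : p.Prime := Fact.out
  induction t using Finset.strongInduction with
  | H t ih =>
  intro hind
  have claim : ∀ j0, ∃ N0, j0 ∈ t →
      ∀ y : ι → A, ϖ ^ N0 ∣ ∑ j ∈ t, β j * y j ^ p → ϖ ∣ y j0 := by
    intro j0
    by_cases hj0 : j0 ∈ t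
    swap
    · exact ⟨0, fun h => absurd h hj0⟩
    by_contra! hcon
    obtain ⟨N0, hN0⟩ := ih (t.erase j0) (Finset.erase_ssubset hj0) (by
      intro y hy j hj
      have := hind (Function.update y j0 0) (by
        rw [← Finset.add_sum_erase _ _ hj0, Function.update_self, zero_pow hp.ne_zero, mul_zero,
          zero_add, ← hy]
        refine Finset.sum_congr rfl fun i hi => ?_
        rw [Function.update_of_ne (Finset.ne_of_mem_erase hi)]) j (Finset.mem_of_mem_erase hj)
      rwa [Function.update_of_ne (Finset.ne_of_mem_erase hj)] at this)
    have hlin := insep_lin h p β (t.erase j0) N0 hN0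
    have hY : ∀ k : ℕ, ∃ y : ι → A,
        ϖ ^ (N0 + p * k) ∣ β j0 + ∑ j ∈ t.erase j0, β j * y j ^ p := by
      intro k
      obtain ⟨-, y, hy, hyj⟩ := hcon (N0 + p * k)
      obtain ⟨u, hu⟩ := (h.h2 (y j0)).resolve_left hyj
      refine ⟨fun j => ↑u⁻¹ * y j, ?_⟩
      refine (hy.mul_left ((↑u⁻¹ : A) ^ p)).trans (dvd_of_eq ?_)
      rw [← Finset.add_sum_erase _ _ hj0, mul_add, Finset.mul_sum]
      congr 1
      · rw [mul_left_comm, ← mul_pow, ← hu]; simp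
      · refine Finset.sum_congr rfl fun i hi => ?_
        rw [mul_pow]; ring
    choose Y hY using hY
    have hcau : ∀ j ∈ t.erase j0, ∀ k, ϖ ^ k ∣ Y (k + 1) j - Y k j := by
      intro j hj k
      refine hlin k (fun j => Y (k + 1) j - Y k j) ?_ j hj
      have h1 := (pow_dvd_pow ϖ (show N0 + p * k ≤ N0 + p * (k + 1) by
        rw [mul_add]; omega)).trans (hY (k + 1))
      have := dvd_sub h1 (hY k)
      convert this using 1
      rw [add_sub_add_left_eq_sub, ← Finset.sum_sub_distrib]
      refine Finset.sum_congr rfl fun i hi => ?_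
      rw [sub_pow_char, mul_sub]
    have hL : ∀ j, ∃ L, j ∈ t.erase j0 → ∀ k, ϖ ^ k ∣ L - Y k j := by
      intro j
      by_cases hj : j ∈ t.erase j0
      · obtain ⟨L, hL⟩ := h.hc (fun k => Y k j) (hcau j hj)
        exact ⟨L, fun _ => hL⟩
      · exact ⟨0, fun h => absurd h hj⟩
    choose L hL using hL
    have hz : β j0 + ∑ j ∈ t.erase j0, β j * L j ^ p = 0 := by
      refine h.h0 _ fun k => ?_
      have h1 := (pow_dvd_pow ϖ (show k ≤ N0 + p * k by nlinarith [hp.one_le])).trans (hY k)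
      have h2 : ϖ ^ k ∣ ∑ j ∈ t.erase j0, β j * (L j - Y k j) ^ p :=
        Finset.dvd_sum fun j hj =>
          Dvd.dvd.mul_left ((hL j hj k).trans (dvd_pow_self _ hp.ne_zero)) _
      convert dvd_add h1 h2 using 1
      rw [add_assoc, ← Finset.sum_add_distrib]
      congr 1
      refine Finset.sum_congr rfl fun i hi => ?_
      rw [sub_pow_char]; ring
    have := hind (Function.update L j0 1) (by
        rw [← Finset.add_sum_erase _ _ hj0, Function.update_self, one_pow, mul_one, ← hz]
        congr 1
        refine Finset.sum_congr rfl fun i hi => ?_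
        rw [Function.update_of_ne (Finset.ne_of_mem_erase hi)]) j0 hj0
    rw [Function.update_self] at this
    exact one_ne_zero this
  choose M hM using claim
  refine ⟨∑ j ∈ t, M j, fun y hy j hj => hM j hj y ((pow_dvd_pow _ ?_).trans hy)⟩
  exact Finset.single_le_sum (f := M) (fun _ _ => Nat.zero_le _) hj

lemma insep_elim (p : ℕ) [Fact p.Prime] [CharP A p] {Q : Type*} [CommRing Q] [IsDomain Q]
    [CharP Q p] [Algebra A Q] [FaithfulSMul A Q] {ι : Type*} (t : Finset ι) :
    ∀ (c : ι → A) (g : ι → Q),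
    (∀ d : ι → A, ∑ i ∈ t, algebraMap A Q (d i) * g i = 0 → ∀ i ∈ t, d i = 0) →
    ∑ i ∈ t, algebraMap A Q (c i) * g i ^ p = 0 → (∃ i ∈ t, c i ≠ 0) →
    ∃ (t' : Finset ι) (β : ι → A) (g' : ι → Q),
      (∀ y : ι → A, ∑ j ∈ t', β j * y j ^ p = 0 → ∀ j ∈ t', y j = 0) ∧
      ∑ i ∈ t', algebraMap A Q (β i) * g' i ^ p = 0 ∧ ∃ j ∈ t', g' j ≠ 0 := by
  classical
  have hp : p.Prime := Fact.out
  have hinj := FaithfulSMul.algebraMap_injective A Q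
  induction t using Finset.strongInduction with
  | H t ih =>
  intro c g hg hsum ⟨i0, hi0, hci0⟩
  by_cases hc : ∀ y : ι → A, ∑ j ∈ t, c j * y j ^ p = 0 → ∀ j ∈ t, y j = 0
  · refine ⟨t, c, g, hc, hsum, i0, hi0, fun h0 => ?_⟩
    have := hg (Pi.single i0 1) (by
      refine Finset.sum_eq_zero fun i hi => ?_
      by_cases hii : i = i0
      · subst hii; simp [h0]
      · simp [Pi.single_eq_of_ne hii]) i0 hi0
    simp at this
  · push Not at hc
    obtain ⟨y, hy, j0, hj0, hyj0⟩ := hc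
    refine ih (t.erase j0) (Finset.erase_ssubset hj0) c
      (fun j => algebraMap A Q (y j0) * g j - algebraMap A Q (y j) * g j0) ?_ ?_ ?_
    · intro d hd i hi
      have hd' := hg (fun i => if i = j0 then - ∑ j ∈ t.erase j0, d j * y j else d i * y j0) (by
        rw [← Finset.add_sum_erase _ _ hj0, if_pos rfl, ← hd, map_neg, map_sum]
        have : ∑ x ∈ t.erase j0, algebraMap A Q (if x = j0 then - ∑ j ∈ t.erase j0, d j * y j
            else d x * y j0) * g x =
            ∑ x ∈ t.erase j0, algebraMap A Q (d x) * (algebraMap A Q (y j0) * g x) := by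
          refine Finset.sum_congr rfl fun x hx => ?_
          rw [if_neg (Finset.ne_of_mem_erase hx), map_mul, mul_assoc]
        rw [this, neg_mul, Finset.sum_mul, neg_add_eq_sub, ← Finset.sum_sub_distrib]
        refine Finset.sum_congr rfl fun x hx => ?_
        rw [map_mul]; ring) i (Finset.mem_of_mem_erase hi)
      rw [if_neg (Finset.ne_of_mem_erase hi)] at hd'
      exact (mul_eq_zero.1 hd').resolve_right hyj0
    · have e1 : ∑ j ∈ t, algebraMap A Q (c j) *
          (algebraMap A Q (y j0) * g j - algebraMap A Q (y j) * g j0) ^ p = 0 := by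
        have e2 : algebraMap A Q (∑ j ∈ t, c j * y j ^ p) = 0 := by rw [hy, map_zero]
        rw [map_sum] at e2
        calc _ = algebraMap A Q (y j0) ^ p * (∑ i ∈ t, algebraMap A Q (c i) * g i ^ p) -
              (∑ x ∈ t, algebraMap A Q (c x * y x ^ p)) * g j0 ^ p := by
              rw [Finset.mul_sum, Finset.sum_mul, ← Finset.sum_sub_distrib]
              refine Finset.sum_congr rfl fun x hx => ?_
              rw [sub_pow_char, mul_pow, mul_pow, map_mul, map_pow]; ring
          _ = 0 := by rw [hsum, e2]; ring
      rw [← Finset.add_sum_erase _ _ hj0, sub_self, zero_pow hp.ne_zero, mul_zero, zero_add] at e1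
      exact e1
    · by_contra! hcon
      rw [← Finset.add_sum_erase _ _ hj0, Finset.sum_eq_zero (s := t.erase j0)
        (fun i hi => by rw [hcon i hi, zero_mul]), add_zero] at hy
      have hcj0 := (mul_eq_zero.1 hy).resolve_right (pow_ne_zero _ hyj0)
      by_cases hii : i0 = j0
      · exact hci0 (hii ▸ hcj0)
      · exact hci0 (hcon i0 (Finset.mem_erase.2 ⟨hii, hi0⟩))

end Insep


lemma sep_data {S C L F : Type*} [CommRing S] [IsDomain S] [CommRing C] [IsDomain C] [Field L]
    [Field F] [IsIntegrallyClosed S] [Algebra S L] [IsFractionRing S L] [Algebra C F]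
    [IsFractionRing C F] [Algebra S C] [Algebra L F] [Algebra S F] [IsScalarTower S C F]
    [IsScalarTower S L F] [FiniteDimensional L F] [Algebra.IsSeparable L F]
    {ι : Type*} [Fintype ι] (x : ι → C) :
    ∃ (θ : C) (f : Polynomial S) (D : S) (G : ι → Polynomial S), D ≠ 0 ∧
      Polynomial.aeval θ f = 0 ∧ Polynomial.aeval θ f.derivative ≠ 0 ∧
      (∀ Q : Polynomial S, Polynomial.aeval θ Q = 0 → f ∣ Q) ∧
      ∀ j, algebraMap S C D * x j = Polynomial.aeval θ (G j) := by
  classical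
  have hCF : Function.Injective (algebraMap C F) := IsFractionRing.injective C F
  have hSF : Function.Injective (algebraMap S F) := by
    rw [IsScalarTower.algebraMap_eq S L F]
    exact (algebraMap L F).injective.comp (IsFractionRing.injective S L)
  have hSC : Function.Injective (algebraMap S C) := by
    rw [IsScalarTower.algebraMap_eq S C F] at hSF
    exact Function.Injective.of_comp hSF
  have algF : Algebra.IsAlgebraic S F :=
    (IsFractionRing.comap_isAlgebraic_iff (K := L)).2 inferInstance
  have algC : ∀ c : C, IsAlgebraic S c := fun c =>
    (isAlgebraic_algebraMap_iff hCF).1 (algF.isAlgebraic (algebraMap C F c))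
  obtain ⟨θ₀, hθ₀⟩ := Field.exists_primitive_element L F
  obtain ⟨u, v, hv, huv⟩ := IsFractionRing.div_surjective (A := C) θ₀
  obtain ⟨d, hd0, w, hw⟩ := (algC v).exists_nonzero_dvd hv
  obtain ⟨y, hy0, hy⟩ := (algC (u * w)).exists_integral_multiple
  set θ : C := y • (u * w) with hθ
  have hv0 : algebraMap C F v ≠ 0 := by
    rw [Ne, map_eq_zero_iff _ hCF]; exact nonZeroDivisors.ne_zero hv
  have e1 : algebraMap C F θ = algebraMap L F (algebraMap S L (y * d)) * θ₀ := by
    rw [hθ, Algebra.smul_def, ← IsScalarTower.algebraMap_apply S L F,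
      IsScalarTower.algebraMap_apply S C F, map_mul (algebraMap S C), hw, ← huv]
    simp only [map_mul]
    field_simp
  have hyd : algebraMap S L (y * d) ≠ 0 := by
    rw [Ne, map_eq_zero_iff _ (IsFractionRing.injective S L)]; exact mul_ne_zero hy0 hd0
  have hprim : IntermediateField.adjoin L {algebraMap C F θ} = ⊤ := by
    rw [eq_top_iff, ← hθ₀, IntermediateField.adjoin_simple_le_iff]
    have h1 : algebraMap C F θ ∈ IntermediateField.adjoin L {algebraMap C F θ} :=
      IntermediateField.mem_adjoin_simple_self L _
    have h2 : θ₀ = (algebraMap S L (y * d))⁻¹ • algebraMap C F θ := by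
      rw [e1, ← Algebra.smul_def, smul_smul, inv_mul_cancel₀ hyd, one_smul]
    rw [h2]
    exact IntermediateField.smul_mem _ h1
  have hex : ∀ j, ∃ (g : Polynomial S) (b : S), b ≠ 0 ∧
      algebraMap S C b * x j = Polynomial.aeval θ g := by
    intro j
    have hmem : algebraMap C F (x j) ∈ (IntermediateField.adjoin L {algebraMap C F θ}).toSubalgebra := by
      rw [hprim]; trivial
    rw [IntermediateField.adjoin_simple_toSubalgebra_of_isAlgebraic (Algebra.IsAlgebraic.isAlgebraic _),
      Algebra.adjoin_singleton_eq_range_aeval] at hmem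
    obtain ⟨q, hq⟩ := hmem
    obtain ⟨b, hb, hbq⟩ := IsLocalization.integerNormalization_spec (nonZeroDivisors S) q
    refine ⟨IsLocalization.integerNormalization (nonZeroDivisors S) q, b, nonZeroDivisors.ne_zero hb, hCF ?_⟩
    rw [← Polynomial.aeval_algebraMap_apply, ← Polynomial.aeval_map_algebraMap L, hbq,
      map_mul, ← IsScalarTower.algebraMap_apply S C F, ← hq, ← Algebra.smul_def]
    have : b • q = (algebraMap S L b) • q := by rw [algebraMap_smul]
    rw [this]
    erw [map_smul (Polynomial.aeval (R := L) (algebraMap C F θ)) (algebraMap S L b) q, algebraMap_smul L b]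
    rfl
  choose g b hb0 hg using hex
  have : Module.IsTorsionFree S C := by
    rw [← faithfulSMul_iff_algebraMap_injective] at hSC; infer_instance
  have hInt : IsIntegral S θ := hy
  refine ⟨θ, minpoly S θ, ∏ j, b j, fun j => Polynomial.C (∏ i ∈ Finset.univ.erase j, b i) * g j,
    Finset.prod_ne_zero_iff.2 fun j _ => hb0 j, minpoly.aeval _ _, ?_,
    fun Q hQ => minpoly.isIntegrallyClosed_dvd hInt hQ, ?_⟩
  · have hsep : (minpoly L (algebraMap C F θ)).Separable := Algebra.IsSeparable.isSeparable L _
    have h1 := hsep.aeval_derivative_ne_zero (S := F) (x := algebraMap C F θ) (minpoly.aeval L _)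
    rw [minpoly.isIntegrallyClosed_eq_field_fractions L F hInt, Polynomial.derivative_map,
      Polynomial.aeval_map_algebraMap, Polynomial.aeval_algebraMap_apply] at h1
    intro h0
    rw [h0, map_zero] at h1
    exact h1 rfl
  · intro j
    rw [map_mul, Polynomial.aeval_C, ← hg j, ← Finset.mul_prod_erase _ _ (Finset.mem_univ j)]
    rw [map_mul]; ring

section dichotomy
open IntermediateField

lemma exists_tb_index {K F : Type*} [Field K] [Field F] [Algebra K F] {N : ℕ} (a : Fin N → F)
    (ha : IntermediateField.adjoin K (Set.range a) = ⊤) :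
    ∃ s : Set (Fin N), IsTranscendenceBasis K (fun i : s => a i) := by
  have : Algebra.IsAlgebraic (Algebra.adjoin K (Set.range a)) F := by
    rw [← isAlgebraic_adjoin_iff_top, ha, Algebra.isAlgebraic_iff_isIntegral]
    exact Algebra.isIntegral_of_surjective topEquiv.surjective
  obtain ⟨t, hts, ht⟩ := exists_isTranscendenceBasis_subset (R := K) (Set.range a)
  obtain ⟨s, hs⟩ := Set.exists_subset_bijOn (a ⁻¹' t) a
  have him : a '' (a ⁻¹' t) = t := Set.image_preimage_eq_of_subset hts
  rw [him] at hs
  exact ⟨s, ht.comp_equiv hs.2.equiv⟩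

lemma sep_dichotomy {K F : Type*} [Field K] [Field F] [Algebra K F] {N : ℕ} (a : Fin N → F)
    (ha : IntermediateField.adjoin K (Set.range a) = ⊤) :
    (∃ s : Set (Fin N), IsTranscendenceBasis K (fun i : s => a i) ∧
      Algebra.IsSeparable (adjoin K (a '' s)) F) ∨
    (∃ p : ℕ, p.Prime ∧ CharP K p ∧ ∃ t : Finset F, LinearIndepOn K id (t : Set F) ∧
      ¬ LinearIndepOn K (fun x : F => x ^ p) (t : Set F)) := by
  obtain ⟨s0, hs0⟩ := exists_tb_index a ha
  obtain _ | ⟨p, hp, hpk⟩ := CharP.exists' K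
  · left
    refine ⟨s0, hs0, ?_⟩
    have : Algebra.IsAlgebraic (IntermediateField.adjoin K (a '' s0)) F := by
      convert! hs0.isAlgebraic_field <;> ext <;> simp
    infer_instance
  by_cases H : ∀ t : Finset F, LinearIndepOn K id (t : Set F) →
      LinearIndepOn K (fun x : F => x ^ p) (t : Set F)
  swap
  · right
    push Not at H
    obtain ⟨t, h1, h2⟩ := H
    exact ⟨p, hp.out, hpk, t, h1, h2⟩
  left
  have : ExpChar K p := .prime hp.out
  obtain ⟨s, hs, hmax⟩ := (Set.toFinite {s : Set (Fin N) |
    IsTranscendenceBasis K (fun i : s => a i)}).exists_maximalFor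
      (fun s => (separableClosure (adjoin K (a '' s)) F).restrictScalars K) _ ⟨s0, hs0⟩
  refine ⟨s, hs, ?_⟩
  rw [← separableClosure.eq_top_iff, ← (restrictScalars_injective K).eq_iff,
    restrictScalars_top, eq_top_iff, ← ha, adjoin_le_iff]
  rintro _ ⟨n, rfl⟩
  by_contra hn
  have hns : n ∉ s := fun h ↦ hn (le_restrictScalars_separableClosure _ (subset_adjoin _ _ ⟨n, h, rfl⟩))
  have ⟨i, hi₁, hi₂⟩ := exists_isTranscendenceBasis_and_isSeparable_of_linearIndepOn_pow'
    p hp.out (a := a) H s n hs hns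
  refine not_lt_iff_le_imp_ge.mpr (hmax hi₁) (SetLike.lt_iff_le_and_exists.mpr ⟨?_, a n, ?_, hn⟩)
  · dsimp only
    rw [separableClosure_le_separableClosure_iff, adjoin_le_iff]
    rintro _ ⟨x, hx, rfl⟩
    obtain rfl | ne := eq_or_ne x i
    exacts [hi₂, le_restrictScalars_separableClosure _ (subset_adjoin _ _ ⟨x, ⟨.inr hx, ne⟩, rfl⟩)]
  · obtain rfl | ne := eq_or_ne n i
    exacts [hi₂, le_restrictScalars_separableClosure _ (subset_adjoin _ _ ⟨n, ⟨.inl rfl, ne⟩, rfl⟩)]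

end dichotomy

lemma sep_case {A B K F : Type*} [CommRing A] [IsDomain A] [IsPrincipalIdealRing A] [CommRing B]
    [IsDomain B] [Field K] [Field F] [Algebra A B] [Algebra A K] [IsFractionRing A K]
    [Algebra B F] [IsFractionRing B F] [Algebra A F] [Algebra K F] [IsScalarTower A B F]
    [IsScalarTower A K F] {N : ℕ} (x : Fin N → B) (a : Fin N → F)
    (hax : ∀ i, a i = algebraMap B F (x i))
    (ha : IntermediateField.adjoin K (Set.range a) = ⊤) (s : Set (Fin N))
    (hs : IsTranscendenceBasis K (fun i : s => a i))
    (hsep : Algebra.IsSeparable (IntermediateField.adjoin K (a '' s)) F) (φ : MvPolynomial s A →+* B)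
    (hφ : φ = (aeval (R := A) (fun i : s => x i)).toRingHom) :
    ∃ (θ : B) (f : Polynomial (MvPolynomial s A)) (D : MvPolynomial s A)
      (G : Fin N → Polynomial (MvPolynomial s A)), φ D ≠ 0 ∧
      f.eval₂ φ θ = 0 ∧ f.derivative.eval₂ φ θ ≠ 0 ∧
      (∀ Q : Polynomial (MvPolynomial s A), Q.eval₂ φ θ = 0 → f ∣ Q) ∧
      ∀ j, φ D * x j = (G j).eval₂ φ θ := by
  classical
  let L := IntermediateField.adjoin K (a '' s)
  have hmem : ∀ i : s, a i ∈ L := fun i => IntermediateField.subset_adjoin _ _ ⟨i, i.2, rfl⟩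
  let ψ : (MvPolynomial s A) →+* F := (aeval (R := A) (fun i : s => a i)).toRingHom
  have hψinj : Function.Injective ψ :=
    AlgebraicIndependent.restrictScalars (R := A) (IsFractionRing.injective A K) hs.1
  have hψφ : ∀ q, ψ q = algebraMap B F (φ q) := by
    intro q
    have : ψ = (algebraMap B F).comp φ := by
      subst hφ
      apply MvPolynomial.ringHom_ext
      · intro r
        simp [ψ, IsScalarTower.algebraMap_apply A B F]
      · intro i; simp [ψ, hax]
    rw [this]; rfl
  have hψL : ∀ q, ψ q ∈ L := by
    intro q
    induction q using MvPolynomial.induction_on with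
    | C r =>
      have : ψ (C r) = algebraMap K F (algebraMap A K r) := by
        simp [ψ, IsScalarTower.algebraMap_apply A K F]
      rw [this]; exact L.algebraMap_mem _
    | add p q hp hq => rw [map_add]; exact L.add_mem hp hq
    | mul_X p i hp =>
      rw [map_mul]; refine L.mul_mem hp ?_
      have : ψ (X i) = a i := by simp [ψ]
      rw [this]; exact hmem i
  let ψL : (MvPolynomial s A) →+* L := ψ.codRestrict L.toSubring hψL
  let i1 : Algebra (MvPolynomial s A) L := ψL.toAlgebra
  let i2 : Algebra (MvPolynomial s A) F := ψ.toAlgebra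
  let i3 : Algebra (MvPolynomial s A) B := φ.toAlgebra
  have : IsScalarTower (MvPolynomial s A) L F := IsScalarTower.of_algebraMap_eq fun q => rfl
  have : IsScalarTower (MvPolynomial s A) B F := IsScalarTower.of_algebraMap_eq fun q => hψφ q
  have : FaithfulSMul (MvPolynomial s A) L := by
    rw [faithfulSMul_iff_algebraMap_injective]
    intro p q hpq
    exact hψinj (congrArg Subtype.val hpq)
  have hfr : ∀ z : F, z ∈ L → ∃ p q : (MvPolynomial s A), z = ψ p / ψ q := by
    intro z hz
    induction hz using IntermediateField.adjoin_induction with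
    | mem z hz =>
      obtain ⟨i, hi, rfl⟩ := hz
      exact ⟨X ⟨i, hi⟩, 1, by simp [ψ]⟩
    | algebraMap z =>
      obtain ⟨u, v, hv, rfl⟩ := IsFractionRing.div_surjective (A := A) z
      exact ⟨C u, C v, by simp [ψ, IsScalarTower.algebraMap_apply A K F]⟩
    | add y z _ _ hy hz =>
      obtain ⟨p, q, rfl⟩ := hy
      obtain ⟨p', q', rfl⟩ := hz
      by_cases hq : ψ q = 0
      · exact ⟨p', q', by rw [hq]; simp⟩
      by_cases hq' : ψ q' = 0
      · exact ⟨p, q, by rw [hq']; simp⟩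
      refine ⟨p * q' + q * p', q * q', ?_⟩
      rw [div_add_div _ _ hq hq']; simp
    | inv z _ hz =>
      obtain ⟨p, q, rfl⟩ := hz
      exact ⟨q, p, by simp⟩
    | mul y z _ _ hy hz =>
      obtain ⟨p, q, rfl⟩ := hy
      obtain ⟨p', q', rfl⟩ := hz
      exact ⟨p * p', q * q', by rw [div_mul_div_comm]; simp⟩
  have : IsFractionRing (MvPolynomial s A) L := IsFractionRing.of_field (MvPolynomial s A) L (by
    rintro ⟨z, hz⟩
    obtain ⟨p, q, h⟩ := hfr z hz
    exact ⟨p, q, Subtype.ext h⟩)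
  have : FiniteDimensional L F := by
    have htop : IntermediateField.adjoin L (Set.range a) = ⊤ := by
      apply IntermediateField.restrictScalars_injective K
      rw [IntermediateField.restrictScalars_top, eq_top_iff, ← ha, IntermediateField.adjoin_le_iff]
      exact IntermediateField.subset_adjoin L _
    have h1 : FiniteDimensional L (IntermediateField.adjoin L (Set.range a)) :=
      IntermediateField.finiteDimensional_adjoin fun y _ => Algebra.IsSeparable.isIntegral L y
    rw [htop] at h1
    exact IntermediateField.topEquiv.toLinearEquiv.finiteDimensional
  obtain ⟨θ, f, D, G, hD, h1, h2, h3, h4⟩ := sep_data (S := MvPolynomial s A) (C := B) (L := L) (F := F) x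
  refine ⟨θ, f, D, G, ?_, h1, h2, h3, h4⟩
  intro h
  apply hD
  apply hψinj
  rw [hψφ, h]; simp

lemma insep_case {A B K F : Type*} [CommRing A] [IsDomain A] [CommRing B]
    [IsDomain B] [Field K] [Field F] [Algebra A B] [Algebra A K] [IsFractionRing A K]
    [Algebra B F] [IsFractionRing B F] [Algebra A F] [Algebra K F] [IsScalarTower A B F]
    [IsScalarTower A K F] (p : ℕ) [Fact p.Prime] [CharP A p] (t : Finset F)
    (h1 : LinearIndepOn K id (t : Set F)) (h2 : ¬ LinearIndepOn K (fun x : F => x ^ p) (t : Set F)) :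
    ∃ (t' : Finset F) (β : F → A) (g : F → B), (∀ y : F → A, ∑ j ∈ t', β j * y j ^ p = 0 →
      ∀ j ∈ t', y j = 0) ∧ ∑ i ∈ t', algebraMap A B (β i) * g i ^ p = 0 ∧ ∃ j ∈ t', g j ≠ 0 := by
  classical
  have hBF : Function.Injective (algebraMap B F) := IsFractionRing.injective B F
  have hAK : Function.Injective (algebraMap A K) := IsFractionRing.injective A K
  have hAF : Function.Injective (algebraMap A F) := by
    rw [IsScalarTower.algebraMap_eq A K F]
    exact (algebraMap K F).injective.comp hAK
  have hAB : Function.Injective (algebraMap A B) := by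
    rw [IsScalarTower.algebraMap_eq A B F] at hAF
    exact Function.Injective.of_comp hAF
  have : FaithfulSMul A B := (faithfulSMul_iff_algebraMap_injective A B).2 hAB
  have : CharP B p := charP_of_injective_algebraMap hAB p
  obtain ⟨b, hb⟩ := IsLocalization.exist_integer_multiples_of_finset (nonZeroDivisors B) t
  have hg : ∀ x : F, ∃ g : B, x ∈ t → algebraMap B F g = algebraMap B F b * x := by
    intro x
    by_cases hx : x ∈ t
    · obtain ⟨g, hg⟩ := hb x hx
      exact ⟨g, fun _ => by rw [hg, Algebra.smul_def]⟩
    · exact ⟨0, fun h => (hx h).elim⟩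
  choose g hg using hg
  have hb0 : algebraMap B F b ≠ 0 := by
    rw [Ne, map_eq_zero_iff _ hBF]; exact nonZeroDivisors.ne_zero b.2
  rw [linearIndepOn_finset_iff] at h1 h2
  push Not at h2
  obtain ⟨k, hk, i0, hi0, hki0⟩ := h2
  obtain ⟨d, hd⟩ := IsLocalization.exist_integer_multiples_of_finset (nonZeroDivisors A) (t.image k)
  have hc : ∀ x : F, ∃ c : A, x ∈ t → algebraMap A K c = algebraMap A K d * k x := by
    intro x
    by_cases hx : x ∈ t
    · obtain ⟨g, hg⟩ := hd (k x) (Finset.mem_image_of_mem _ hx)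
      exact ⟨g, fun _ => by rw [hg, Algebra.smul_def]⟩
    · exact ⟨0, fun h => (hx h).elim⟩
  choose c hc using hc
  have hd0 : algebraMap A K d ≠ 0 := by
    rw [Ne, map_eq_zero_iff _ hAK]; exact nonZeroDivisors.ne_zero d.2
  refine insep_elim p t c g ?_ ?_ ⟨i0, hi0, ?_⟩
  · intro e he i hi
    have := h1 (fun x => algebraMap A K (e x)) ?_ i hi
    · exact (map_eq_zero_iff _ hAK).1 this
    have he' := congrArg (algebraMap B F) he
    rw [map_sum, map_zero] at he'
    have : algebraMap B F b * ∑ x ∈ t, algebraMap A K (e x) • id x = 0 := by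
      rw [← he', Finset.mul_sum]
      refine Finset.sum_congr rfl fun x hx => ?_
      rw [map_mul, hg x hx, Algebra.smul_def, ← IsScalarTower.algebraMap_apply A K F,
        ← IsScalarTower.algebraMap_apply A B F, id]
      ring
    exact (mul_eq_zero.1 this).resolve_left hb0
  · apply hBF
    rw [map_sum, map_zero]
    have : ∑ x ∈ t, algebraMap B F (algebraMap A B (c x) * g x ^ p) =
        algebraMap K F (algebraMap A K d) * algebraMap B F b ^ p * ∑ x ∈ t, k x • x ^ p := by
      rw [Finset.mul_sum]
      refine Finset.sum_congr rfl fun x hx => ?_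
      rw [map_mul, map_pow, hg x hx, ← IsScalarTower.algebraMap_apply A B F,
        IsScalarTower.algebraMap_apply A K F, hc x hx, map_mul, Algebra.smul_def]
      ring
    rw [this, hk, mul_zero]
  · intro h0
    have := hc i0 hi0
    rw [h0, map_zero] at this
    exact mul_ne_zero hd0 hki0 this.symm

lemma prime_alt {A : Type*} [CommRing A] [IsDomain A] [IsPrincipalIdealRing A] {N : ℕ}
    (P : Ideal (MvPolynomial (Fin N) A)) [P.IsPrime] (hP : ∀ r, C r ∈ P → r = 0) :
    (∃ (s : Set (Fin N)) (ρ : MvPolynomial s A →+* MvPolynomial (Fin N) A)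
      (T : MvPolynomial (Fin N) A) (f : Polynomial (MvPolynomial s A)) (D : MvPolynomial s A)
      (G : Fin N → Polynomial (MvPolynomial s A)),
      (∀ a q, eval a (ρ q) = eval (fun i : s => a i) q) ∧ (∀ r, ρ (C r) = C r) ∧
      f.eval₂ ρ T ∈ P ∧ (∀ Q : Polynomial (MvPolynomial s A), Q.eval₂ ρ T ∈ P → f ∣ Q) ∧
      (∀ j, ρ D * X j - (G j).eval₂ ρ T ∈ P) ∧ ρ D * f.derivative.eval₂ ρ T ∉ P) ∨
    (∃ (p : ℕ) (ι : Type) (t : Finset ι) (β : ι → A) (g : ι → MvPolynomial (Fin N) A),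
      p.Prime ∧ CharP A p ∧ (∀ y : ι → A, ∑ j ∈ t, β j * y j ^ p = 0 → ∀ j ∈ t, y j = 0) ∧
      ∑ i ∈ t, C (β i) * g i ^ p ∈ P ∧ ∃ j ∈ t, g j ∉ P) := by
  classical
  let B := MvPolynomial (Fin N) A ⧸ P
  let π : MvPolynomial (Fin N) A →+* B := Ideal.Quotient.mk P
  let F := FractionRing B
  have hAB : Function.Injective (algebraMap A B) := by
    rw [injective_iff_map_eq_zero]
    intro r hr
    exact hP r (Ideal.Quotient.eq_zero_iff_mem.1 hr)
  have hAF : Function.Injective (algebraMap A F) := by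
    rw [IsScalarTower.algebraMap_eq A B F]
    exact (IsFractionRing.injective B F).comp hAB
  have : FaithfulSMul A F := (faithfulSMul_iff_algebraMap_injective A F).2 hAF
  let K := FractionRing A
  let iKF : Algebra K F := FractionRing.liftAlgebra A F
  have : IsScalarTower A K F := FractionRing.isScalarTower_liftAlgebra A F
  let x : Fin N → B := fun i => π (X i)
  let a : Fin N → F := fun i => algebraMap B F (x i)
  have ha : IntermediateField.adjoin K (Set.range a) = ⊤ := by
    rw [eq_top_iff]
    intro z _
    have key : ∀ q, algebraMap B F (π q) ∈ IntermediateField.adjoin K (Set.range a) := by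
      intro q
      induction q using MvPolynomial.induction_on with
      | C r =>
        have : algebraMap B F (π (C r)) = algebraMap K F (algebraMap A K r) := by
          rw [← IsScalarTower.algebraMap_apply A K F, IsScalarTower.algebraMap_apply A B F]; rfl
        rw [this]; exact IntermediateField.algebraMap_mem _ _
      | add p q hp hq => rw [map_add, map_add]; exact add_mem hp hq
      | mul_X p i hp =>
        rw [map_mul, map_mul]
        exact mul_mem hp (IntermediateField.subset_adjoin _ _ ⟨i, rfl⟩)
    obtain ⟨u, v, hv, rfl⟩ := IsFractionRing.div_surjective (A := B) z
    obtain ⟨u, rfl⟩ := Ideal.Quotient.mk_surjective u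
    obtain ⟨v, rfl⟩ := Ideal.Quotient.mk_surjective v
    exact div_mem (key u) (key v)
  rcases sep_dichotomy (K := K) a ha with ⟨s, hs, hsep⟩ | ⟨p, hp, hpK, t, h1, h2⟩
  · left
    let ρ : MvPolynomial s A →+* MvPolynomial (Fin N) A := (rename (R := A) Subtype.val).toRingHom
    have hφ : π.comp ρ = (aeval (R := A) (fun i : s => x i)).toRingHom := by
      apply MvPolynomial.ringHom_ext
      · intro r
        simp only [RingHom.comp_apply, ρ]
        simp
        rfl
      · intro i
        simp [ρ, x]
    obtain ⟨θ, f, D, G, hD, h1, h2, h3, h4⟩ := sep_case (A := A) (B := B) (K := K) (F := F) x a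
      (fun _ => rfl) ha s hs hsep (π.comp ρ) hφ
    obtain ⟨T, rfl⟩ := Ideal.Quotient.mk_surjective θ
    have e : ∀ Q : Polynomial (MvPolynomial s A),
        Q.eval₂ (π.comp ρ) (Ideal.Quotient.mk P T) = π (Q.eval₂ ρ T) := by
      intro Q
      rw [Polynomial.hom_eval₂]
    simp only [e] at h1 h2 h3 h4
    refine ⟨s, ρ, T, f, D, G, ?_, ?_, Ideal.Quotient.eq_zero_iff_mem.1 h1,
      fun Q hQ => h3 Q (Ideal.Quotient.eq_zero_iff_mem.2 hQ), fun j => ?_, ?_⟩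
    · intro a q
      simp only [ρ]
      change eval a (rename Subtype.val q) = _
      rw [eval_rename]; rfl
    · intro r; simp [ρ]
    · rw [← Ideal.Quotient.eq_zero_iff_mem, map_sub, map_mul, sub_eq_zero]
      exact h4 j
    · intro hmem
      rcases Ideal.IsPrime.mem_or_mem ‹P.IsPrime› hmem with h | h
      · exact hD (Ideal.Quotient.eq_zero_iff_mem.2 h)
      · exact h2 (Ideal.Quotient.eq_zero_iff_mem.2 h)
  · right
    have : Fact p.Prime := ⟨hp⟩
    have hpA : CharP A p := (algebraMap A K).charP (IsFractionRing.injective A K) p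
    obtain ⟨t', β, g, hβ, hg, j, hj, hgj⟩ := insep_case (A := A) (B := B) (K := K) (F := F) p t h1 h2
    choose G hG using fun i => Ideal.Quotient.mk_surjective (g i)
    let em := t'.equivFin
    refine ⟨p, Fin t'.card, Finset.univ, fun i => β (em.symm i), fun i => G (em.symm i), hp, hpA, ?_, ?_,
      em ⟨j, hj⟩, Finset.mem_univ _, ?_⟩
    · intro y hy i _
      let y' : F → A := fun z => if hz : z ∈ t' then y (em ⟨z, hz⟩) else 0
      have := hβ y' (by
        rw [← hy, ← Finset.sum_coe_sort t', ← Equiv.sum_comp em.symm]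
        refine Finset.sum_congr rfl fun i _ => ?_
        simp [y']) (em.symm i) (em.symm i).2
      simpa [y'] using this
    · rw [← Ideal.Quotient.eq_zero_iff_mem, ← hg, map_sum, ← Finset.sum_coe_sort t',
        ← Equiv.sum_comp em.symm]
      refine Finset.sum_congr rfl fun i _ => ?_
      rw [map_mul, map_pow, hG]; rfl
    · rw [← Ideal.Quotient.eq_zero_iff_mem, hG]
      simpa using hgj

/-- Linear approximation property for an ideal of polynomials. -/
def LAP {A : Type*} [CommRing A] (ϖ : A) {N : ℕ} (I : Ideal (MvPolynomial (Fin N) A)) : Prop :=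
  ∃ c e : ℕ, ∀ (n : ℕ) (a : Fin N → A), (∀ f ∈ I, ϖ ^ (c * n + e) ∣ eval a f) →
    ∃ b : Fin N → A, (∀ f ∈ I, eval b f = 0) ∧ ∀ j, ϖ ^ n ∣ a j - b j

lemma dvd_sup_span {A : Type*} [CommRing A] {N : ℕ} {I : Ideal (MvPolynomial (Fin N) A)}
    {g : MvPolynomial (Fin N) A} {a : Fin N → A} {d : A} (hI : ∀ f ∈ I, d ∣ eval a f)
    (hg : d ∣ eval a g) : ∀ f ∈ I ⊔ Ideal.span {g}, d ∣ eval a f := by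
  intro f hf
  obtain ⟨u, hu, v, hv, rfl⟩ := Submodule.mem_sup.1 hf
  obtain ⟨w, rfl⟩ := Ideal.mem_span_singleton'.1 hv
  rw [map_add, map_mul]
  exact dvd_add (hI u hu) (hg.mul_left _)

lemma lt_sup_span {B : Type*} [CommRing B] {I : Ideal B} {g : B} (hg : g ∉ I) :
    I < I ⊔ Ideal.span {g} := by
  refine lt_of_le_of_ne le_sup_left fun h => hg ?_
  rw [h]
  exact Ideal.mem_sup_right (Ideal.mem_span_singleton_self g)

theorem greenberg {A : Type*} [CommRing A] [IsDomain A] [IsPrincipalIdealRing A] {ϖ : A}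
    (h : CDV A ϖ) {N : ℕ} (I : Ideal (MvPolynomial (Fin N) A)) : LAP ϖ I := by
  induction I using IsNoetherian.induction with
  | hgt I ih =>
  have ih' : ∀ g ∉ I, ∃ c e : ℕ, ∀ (n : ℕ) (a : Fin N → A),
      (∀ f ∈ I, ϖ ^ (c * n + e) ∣ eval a f) → ϖ ^ (c * n + e) ∣ eval a g →
      ∃ b : Fin N → A, (∀ f ∈ I, eval b f = 0) ∧ ∀ j, ϖ ^ n ∣ a j - b j := by
    intro g hg
    obtain ⟨c, e, hce⟩ := ih _ (lt_sup_span hg)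
    refine ⟨c, e, fun n a h1 h2 => ?_⟩
    obtain ⟨b, hb, hab⟩ := hce n a (dvd_sup_span h1 h2)
    exact ⟨b, fun f hf => hb f (Ideal.mem_sup_left hf), hab⟩
  have mono : ∀ {k l : ℕ} {a : Fin N → A}, l ≤ k → (∀ f ∈ I, ϖ ^ k ∣ eval a f) →
      ∀ f ∈ I, ϖ ^ l ∣ eval a f := fun hkl H f hf => (pow_dvd_pow _ hkl).trans (H f hf)
  -- a nonzero constant in `I`
  by_cases hconst : ∃ r, C r ∈ I ∧ r ≠ 0
  · obtain ⟨r, hr, hr0⟩ := hconst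
    have : ∃ k, ¬ ϖ ^ k ∣ r := by
      by_contra hcon
      push Not at hcon
      exact hr0 (h.h0 r hcon)
    obtain ⟨k, hk⟩ := this
    refine ⟨0, k, fun n a H => (hk ?_).elim⟩
    simpa using H _ hr
  have hconst' : ∀ r, C r ∈ I → r = 0 := by
    intro r hr; by_contra h0; exact hconst ⟨r, hr, h0⟩
  by_cases hprime : Ideal.IsPrime I
  swap
  · have hne : I ≠ ⊤ := by
      rintro rfl
      exact hconst ⟨1, trivial, one_ne_zero⟩
    have : ∃ f g, f * g ∈ I ∧ f ∉ I ∧ g ∉ I := by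
      by_contra hcon
      push Not at hcon
      exact hprime ⟨hne, fun {x y} hxy => or_iff_not_imp_left.2 (hcon x y hxy)⟩
    obtain ⟨f, g, hfg, hf, hg⟩ := this
    obtain ⟨c1, e1, H1⟩ := ih' f hf
    obtain ⟨c2, e2, H2⟩ := ih' g hg
    refine ⟨c1 + c2, e1 + e2, fun n a H => ?_⟩
    have e : (c1 + c2) * n + (e1 + e2) = (c1 * n + e1) + (c2 * n + e2) := by ring
    rw [e] at H
    have := H _ hfg
    rw [map_mul] at this
    rcases h.mul this with h1 | h1
    · exact H1 n a (mono (by omega) H) h1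
    · exact H2 n a (mono (by omega) H) h1
  rcases prime_alt I hconst' with ⟨s, ρ, T, f, D, G, hρ, hρC, hf, hker, hG, hnot⟩ |
    ⟨p, ι, t, β, g, hp, hpA, hβ, hg, j, hj, hgj⟩
  · obtain ⟨c, e, H1⟩ := ih' _ hnot
    refine ⟨3 * c + 1, 3 * e + 1, fun n a H => ?_⟩
    have ee : (3 * c + 1) * n + (3 * e + 1) = 3 * (c * n + e) + n + 1 := by ring
    rw [ee] at H
    by_cases hd : ϖ ^ (c * n + e) ∣ eval a (ρ D * f.derivative.eval₂ ρ T)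
    · exact H1 n a (mono (by omega) H) hd
    · exact lift_sep h I s ρ T hρ hρC f D G hf hker hG a _ n hd H
  · have : Fact p.Prime := ⟨hp⟩
    obtain ⟨N0, hN0⟩ := insep_one h p β t hβ
    obtain ⟨c, e, H1⟩ := ih' _ hgj
    refine ⟨p * c, p * e + N0, fun n a H => ?_⟩
    have ee : (p * c) * n + (p * e + N0) = N0 + p * (c * n + e) := by ring
    rw [ee] at H
    have hle : c * n + e ≤ N0 + p * (c * n + e) :=
      (Nat.le_mul_of_pos_left _ hp.pos).trans (Nat.le_add_left _ _)
    refine H1 n a (mono hle H) ?_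
    have := H _ hg
    simp only [map_sum, map_mul, map_pow, eval_C] at this
    exact insep_lin h p β t N0 hN0 (c * n + e) (fun i => eval a (g i)) this j hj

/-- Abstract `t`-adic completeness, stated with divisibility. -/
def SeqComplete {A : Type*} [CommRing A] (t : A) : Prop :=
  ∀ u : ℕ → A, (∀ n, t ^ n ∣ u (n + 1) - u n) → ∃ L, ∀ n, t ^ n ∣ L - u n

lemma cauchy_dvd {A : Type*} [CommRing A] {t : A} {u : ℕ → A} (hu : ∀ n, t ^ n ∣ u (n + 1) - u n)
    (n : ℕ) : ∀ m, n ≤ m → t ^ n ∣ u m - u n := by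
  intro m hm
  induction m, hm using Nat.le_induction with
  | base => simp
  | succ m hm ih =>
    have := dvd_add ((pow_dvd_pow t hm).trans (hu m)) ih
    simpa using this

lemma seqComplete_of_adic {R : Type*} [CommRing R] {I : Ideal R} [IsAdicComplete I R] {t : R}
    (ht : t ∈ I) {k : ℕ} (hk : I ^ k ≤ Ideal.span {t}) : SeqComplete t := by
  intro u hu
  have hmem : ∀ n z, t ^ n ∣ z → z ∈ I ^ n := by
    rintro n _ ⟨w, rfl⟩
    exact Ideal.mul_mem_right _ _ (Ideal.pow_mem_pow ht n)
  obtain ⟨L, hL⟩ := IsPrecomplete.prec (I := I) (M := R) inferInstance (f := u) (by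
    intro m n hmn
    rw [SModEq.sub_mem, ← neg_sub]
    simp only [smul_eq_mul, Ideal.mul_top]
    exact neg_mem (hmem _ _ (cauchy_dvd hu m n hmn)))
  refine ⟨L, fun n => ?_⟩
  have h1 := hL (k * n + n)
  rw [SModEq.sub_mem] at h1
  simp only [smul_eq_mul, Ideal.mul_top] at h1
  have h2 : u (k * n + n) - L ∈ Ideal.span {t ^ n} := by
    rw [← Ideal.span_singleton_pow]
    refine (Ideal.pow_right_mono hk n) ?_
    rw [← pow_mul]
    exact Ideal.pow_le_pow_right (Nat.le_add_right _ _) h1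
  have h3 := Ideal.mem_span_singleton.1 h2
  have h4 := cauchy_dvd hu n (k * n + n) (Nat.le_add_left _ _)
  have := dvd_sub h4 h3
  simpa using this

lemma adic_of_seqComplete {A : Type*} [CommRing A] {t : A} (h : SeqComplete t)
    (h0 : ∀ x, (∀ n, t ^ n ∣ x) → x = 0) : IsAdicComplete (Ideal.span {t}) A where
  haus' x hx := by
    refine h0 x fun n => ?_
    have := hx n
    rw [SModEq.sub_mem] at this
    simp only [smul_eq_mul, Ideal.mul_top, Ideal.span_singleton_pow, sub_zero] at this
    exact Ideal.mem_span_singleton.1 this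
  prec' f hf := by
    obtain ⟨L, hL⟩ := h f (by
      intro n
      have := hf (Nat.le_succ n)
      rw [SModEq.sub_mem] at this
      simp only [smul_eq_mul, Ideal.mul_top, Ideal.span_singleton_pow] at this
      have := Ideal.mem_span_singleton.1 this
      rwa [← dvd_neg, neg_sub] at this)
    refine ⟨L, fun n => ?_⟩
    rw [SModEq.sub_mem]
    simp only [smul_eq_mul, Ideal.mul_top, Ideal.span_singleton_pow]
    rw [Ideal.mem_span_singleton, ← dvd_neg, neg_sub]
    exact hL n

section conductor
variable {R S : Type*} [CommRing R] [IsDomain R] [CommRing S] [IsDomain S] [Algebra R S]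
  [FaithfulSMul R S] [Algebra.IsIntegral R S]

lemma cond_haus {t : R} (ht : ¬ IsUnit t) (ht0 : t ≠ 0) (hrad : ∀ s : R, s ≠ 0 → ∃ e, s ∣ t ^ e)
    (z : S) (hz : ∀ n, algebraMap R S t ^ n ∣ z) : z = 0 := by
  by_contra hz0
  have hinj := FaithfulSMul.algebraMap_injective R S
  obtain ⟨s, hs0, hzs⟩ := (Algebra.IsIntegral.isIntegral (R := R) z).isAlgebraic.exists_nonzero_dvd
    (mem_nonZeroDivisors_of_ne_zero hz0)
  obtain ⟨e, he⟩ := hrad s hs0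
  have h1 : algebraMap R S t ^ (e + 1) ∣ algebraMap R S t ^ e := by
    refine (hz _).trans (hzs.trans ?_)
    rw [← map_pow]; exact map_dvd _ he
  have hT0 : algebraMap R S t ≠ 0 := by rwa [Ne, map_eq_zero_iff _ hinj]
  have h2 : IsUnit (algebraMap R S t) := by
    obtain ⟨w, hw⟩ := h1
    have : algebraMap R S t ^ e * 1 = algebraMap R S t ^ e * (algebraMap R S t * w) := by
      rw [mul_one]; conv_lhs => rw [hw]
      ring
    exact IsUnit.of_mul_eq_one _ (mul_left_cancel₀ (pow_ne_zero e hT0) this).symm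
  exact ht ((isUnit_map_iff (algebraMap R S) t).1 h2)

lemma cond_stab [IsNoetherianRing R] [Ring.KrullDimLE 1 R] {t : R} (ht0 : t ≠ 0) :
    ∃ e, ∀ n, e ≤ n → ∀ r : R, algebraMap R S t ^ e ∣ algebraMap R S r →
      ∃ r1 r2 : R, r = r1 + t * r2 ∧ algebraMap R S t ^ n ∣ algebraMap R S r1 := by
  have hfl := isFiniteLength_quotient_span_singleton R (mem_nonZeroDivisors_of_ne_zero ht0)
  have hart : IsArtinian R (R ⧸ Ideal.span {t}) := (isFiniteLength_iff_isNoetherian_isArtinian.1 hfl).2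
  let W : ℕ → Submodule R (R ⧸ Ideal.span {t}) := fun n =>
    Submodule.map (Submodule.mkQ (Ideal.span {t}))
      (Ideal.comap (algebraMap R S) (Ideal.span {algebraMap R S t ^ n}))
  have hW : Antitone W := by
    intro m n hmn
    refine Submodule.map_mono (Ideal.comap_mono ?_)
    rw [Ideal.span_singleton_le_span_singleton]
    exact pow_dvd_pow _ hmn
  obtain ⟨e, he⟩ := IsArtinian.monotone_stabilizes
    (⟨fun n => OrderDual.toDual (W n), fun m n hmn => hW hmn⟩ : ℕ →o (Submodule R (R ⧸ Ideal.span {t}))ᵒᵈ)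
  refine ⟨e, fun n hn r hr => ?_⟩
  have hen : W e = W n := he n hn
  have h1 : Submodule.mkQ (Ideal.span {t}) r ∈ W e :=
    Submodule.mem_map_of_mem (Ideal.mem_comap.2 (Ideal.mem_span_singleton.2 hr))
  rw [hen] at h1
  obtain ⟨r1, hr1, hrr⟩ := h1
  have h2 : r - r1 ∈ Ideal.span {t} := by
    rw [Submodule.mkQ_apply, Submodule.mkQ_apply, eq_comm] at hrr
    exact (Submodule.Quotient.eq _).1 hrr
  obtain ⟨r2, hr2⟩ := Ideal.mem_span_singleton.1 h2
  exact ⟨r1, r2, by rw [← hr2]; ring, Ideal.mem_span_singleton.1 (Ideal.mem_comap.1 hr1)⟩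

lemma cond_approx {t : R} (ht0 : t ≠ 0) (e : ℕ)
    (he : ∀ n, e ≤ n → ∀ r : R, algebraMap R S t ^ e ∣ algebraMap R S r →
      ∃ r1 r2 : R, r = r1 + t * r2 ∧ algebraMap R S t ^ n ∣ algebraMap R S r1)
    (n : ℕ) (hn : e ≤ n) (j : ℕ) : ∀ x : S, algebraMap R S t ^ e ∣ x →
      (∃ r, algebraMap R S t ^ j * x = algebraMap R S r) →
      ∃ r, algebraMap R S t ^ n ∣ x - algebraMap R S r := by
  have hinj := FaithfulSMul.algebraMap_injective R S
  have hT0 : algebraMap R S t ≠ 0 := by rwa [Ne, map_eq_zero_iff _ hinj]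
  induction j with
  | zero =>
    rintro x - ⟨r, hr⟩
    exact ⟨r, by rw [← hr]; simp⟩
  | succ j ih =>
    rintro x hx ⟨r, hr⟩
    obtain ⟨r1, r2, h12, y, hy⟩ := he (n + j + 1) (by omega) r
      (by rw [← hr]; exact hx.mul_left _)
    have key : algebraMap R S t ^ j * (x - algebraMap R S t ^ n * y) = algebraMap R S r2 := by
      apply mul_left_cancel₀ hT0
      have e1 : algebraMap R S t * (algebraMap R S t ^ j * (x - algebraMap R S t ^ n * y)) =
        algebraMap R S t ^ (j + 1) * x - algebraMap R S t ^ (n + j + 1) * y := by ring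
      rw [e1, hr, ← hy, h12]; simp
    obtain ⟨r', hr'⟩ := ih (x - algebraMap R S t ^ n * y)
      (dvd_sub hx ((pow_dvd_pow _ hn).mul_right _)) ⟨r2, key⟩
    refine ⟨r', ?_⟩
    have := dvd_add hr' (dvd_mul_right (algebraMap R S t ^ n) y)
    convert this using 1; ring

lemma cond_exists [IsNoetherianRing R] [Ring.KrullDimLE 1 R] {t : R} (ht : ¬ IsUnit t)
    (ht0 : t ≠ 0) (hrad : ∀ s : R, s ≠ 0 → ∃ e, s ∣ t ^ e) (hcomp : SeqComplete t)
    (hfrac : ∀ z : S, ∃ s : R, s ≠ 0 ∧ ∃ r, algebraMap R S s * z = algebraMap R S r) :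
    ∃ e, ∀ y : S, ∃ r, algebraMap R S t ^ e * y = algebraMap R S r := by
  obtain ⟨e, he⟩ := cond_stab (S := S) ht0
  refine ⟨e, fun y0 => ?_⟩
  have hstep : ∀ y : S, ∃ (y' : S) (r : R),
      algebraMap R S t ^ e * y = algebraMap R S t ^ (e + 1) * y' + algebraMap R S r := by
    intro y
    obtain ⟨s, hs0, r, hr⟩ := hfrac (algebraMap R S t ^ e * y)
    obtain ⟨j, d, hd⟩ := hrad s hs0
    obtain ⟨r', y', hy'⟩ := cond_approx ht0 e he (e + 1) (Nat.le_succ e) j (algebraMap R S t ^ e * y)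
      (dvd_mul_right _ _) ⟨d * r, by
        rw [← map_pow, hd, map_mul, map_mul, ← hr]; ring⟩
    exact ⟨y', r', by rw [← hy']; ring⟩
  choose Y ρ hY using hstep
  let y : ℕ → S := fun n => Y^[n] y0
  have hy0 : y 0 = y0 := rfl
  have hys : ∀ n, y (n + 1) = Y (y n) := fun n => Function.iterate_succ_apply' _ _ _
  let p : ℕ → R := fun n => ∑ i ∈ Finset.range n, t ^ i * ρ (y i)
  have hp : ∀ n, algebraMap R S t ^ e * y0 = algebraMap R S (p n) + algebraMap R S t ^ (n + e) * y n := by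
    intro n
    induction n with
    | zero => simp [p, hy0]
    | succ n ih =>
      rw [ih, hys]
      have h1 : algebraMap R S t ^ (n + e) * y n =
        algebraMap R S t ^ n * (algebraMap R S t ^ (e + 1) * Y (y n) + algebraMap R S (ρ (y n))) := by
        rw [← hY]; ring
      rw [h1]
      simp only [p, Finset.sum_range_succ, map_add, map_mul, map_pow]
      ring
  obtain ⟨L, hL⟩ := hcomp p (fun n => by simp [p, Finset.sum_range_succ])
  refine ⟨L, ?_⟩
  rw [← sub_eq_zero]
  refine cond_haus ht ht0 hrad _ fun n => ?_
  have h1 : algebraMap R S t ^ n ∣ algebraMap R S (L - p n) := by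
    rw [← map_pow]; exact map_dvd _ (hL n)
  rw [hp n]
  have h2 : algebraMap R S t ^ n ∣ algebraMap R S t ^ (n + e) * y n :=
    (pow_dvd_pow _ (Nat.le_add_right _ _)).mul_right _
  have := dvd_sub h2 h1
  convert this using 1
  rw [map_sub]; ring

lemma cond_complete {t : R} (ht0 : t ≠ 0) (hcomp : SeqComplete t) {e : ℕ}
    (he : ∀ y : S, ∃ r, algebraMap R S t ^ e * y = algebraMap R S r) :
    SeqComplete (algebraMap R S t) := by
  have hinj := FaithfulSMul.algebraMap_injective R S
  have hT0 : algebraMap R S t ≠ 0 := by rwa [Ne, map_eq_zero_iff _ hinj]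
  intro u hu
  choose r hr using fun n => he (u n)
  obtain ⟨L, hL⟩ := hcomp r (by
    intro n
    obtain ⟨w, hw⟩ := hu n
    obtain ⟨s, hs⟩ := he w
    refine ⟨s, hinj ?_⟩
    rw [map_sub, ← hr, ← hr, ← mul_sub, hw, map_mul, ← hs, map_pow]; ring)
  obtain ⟨q, hq⟩ := hL e
  have hL' : algebraMap R S L = algebraMap R S t ^ e * (algebraMap R S q + u e) := by
    have : L = t ^ e * q + r e := by rw [← hq]; ring
    rw [this, map_add, ← hr, map_mul, map_pow]; ring
  refine ⟨algebraMap R S q + u e, fun n => ?_⟩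
  have h1 : algebraMap R S t ^ n ∣ algebraMap R S q + u e - u (n + e) := by
    obtain ⟨w, hw⟩ := hL (n + e)
    refine ⟨algebraMap R S w, mul_left_cancel₀ (pow_ne_zero e hT0) ?_⟩
    rw [mul_sub, ← hL', hr, ← map_sub, hw, map_mul, map_pow]; ring
  have h2 := cauchy_dvd hu n (n + e) (Nat.le_add_right _ _)
  have := dvd_add h1 h2
  simpa using this

lemma cond_noeth [IsNoetherianRing R] {t : R} (ht0 : t ≠ 0) {e : ℕ}
    (he : ∀ y : S, ∃ r, algebraMap R S t ^ e * y = algebraMap R S r) : IsNoetherianRing S := by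
  have hinj := FaithfulSMul.algebraMap_injective R S
  have hT0 : algebraMap R S t ≠ 0 := by rwa [Ne, map_eq_zero_iff _ hinj]
  let g : S →ₗ[R] LinearMap.range (Algebra.linearMap R S) :=
    LinearMap.codRestrict _ (LinearMap.mulLeft R (algebraMap R S t ^ e)) (by
      intro y
      obtain ⟨r, hr⟩ := he y
      exact ⟨r, hr.symm⟩)
  have hg : Function.Injective g := by
    intro x y hxy
    exact mul_left_cancel₀ (pow_ne_zero e hT0) (congrArg Subtype.val hxy)
  have := isNoetherian_of_injective g hg
  exact isNoetherian_of_tower R this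

end conductor

lemma local_of_complete {S : Type*} [CommRing S] [IsDomain S] [IsNoetherianRing S]
    [Ring.KrullDimLE 1 S] {T : S} (hT0 : T ≠ 0) [IsAdicComplete (Ideal.span {T}) S] :
    IsLocalRing S := by
  have hfl := isFiniteLength_quotient_span_singleton S (mem_nonZeroDivisors_of_ne_zero hT0)
  have hart : IsArtinian S (S ⧸ Ideal.span {T}) :=
    (isFiniteLength_iff_isNoetherian_isArtinian.1 hfl).2
  have hjac := IsAdicComplete.le_jacobson_bot (Ideal.span {T})
  have hunit : ∀ z, T ∣ z → IsUnit (1 - z) := by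
    intro z hz
    have h1 : z ∈ (⊥ : Ideal S).jacobson := hjac (Ideal.mem_span_singleton.2 hz)
    have := Ideal.mem_jacobson_bot.1 h1 (-1)
    convert this using 1; ring
  refine IsLocalRing.of_isUnit_or_isUnit_one_sub_self fun x => ?_
  obtain ⟨k, y, hy⟩ := IsArtinian.exists_pow_succ_smul_dvd x (Ideal.Quotient.mk (Ideal.span {T}) 1)
  obtain ⟨y, rfl⟩ := Ideal.Quotient.mk_surjective y
  let π := Ideal.Quotient.mk (Ideal.span {T})
  have hπ : ∀ z, π z = 0 ↔ T ∣ z := fun z => by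
    rw [Ideal.Quotient.eq_zero_iff_mem, Ideal.mem_span_singleton]
  have hy' : π x ^ (k + 1) * π y = π x ^ k := by
    have h1 : x ^ k.succ • π y = π (x ^ (k + 1) * y) := by rw [Algebra.smul_def, map_mul]; rfl
    have h2 : x ^ k • π 1 = π (x ^ k) := by
      rw [Algebra.smul_def, map_one, mul_one]; rfl
    have h3 : x ^ k.succ • π y = x ^ k • π 1 := hy
    rw [h1, h2] at h3
    simpa using h3
  have hyk : ∀ i, π x ^ (k + 1 + i) * π y ^ i = π x ^ (k + 1) := by
    intro i
    induction i with
    | zero => simp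
    | succ i ih =>
      calc π x ^ (k + 1 + (i + 1)) * π y ^ (i + 1)
          = (π x ^ (k + 1) * π y) * π x ^ (i + 1) * π y ^ i := by ring
        _ = π x ^ (k + 1 + i) * π y ^ i := by rw [hy']; ring
        _ = _ := ih
  set m := k + 1 with hm
  have hm2 := hyk m
  let E := x ^ m * y ^ m
  have hE : π E * π E = π E := by
    simp only [E, map_mul, map_pow]
    calc π x ^ m * π y ^ m * (π x ^ m * π y ^ m) = (π x ^ (m + m) * π y ^ m) * π y ^ m := by ring
      _ = _ := by rw [hm2]
  have : HenselianRing S (Ideal.span {T}) := IsAdicComplete.henselianRing S _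
  obtain ⟨a, ha, haE⟩ := HenselianRing.is_henselian (I := Ideal.span {T})
    (Polynomial.X ^ 2 - Polynomial.X) (by monicity!) E (by
      rw [← Ideal.Quotient.eq_zero_iff_mem]
      change π _ = 0
      simp only [Polynomial.eval_sub, Polynomial.eval_pow, Polynomial.eval_X, map_sub, map_pow]
      rw [pow_two, hE, sub_self]) (by
      change IsUnit (π _)
      simp only [Polynomial.derivative_sub, Polynomial.derivative_X_pow, Polynomial.derivative_X,
        Polynomial.eval_sub, Polynomial.eval_mul, Polynomial.eval_pow, Polynomial.eval_X,
        Polynomial.eval_one, Polynomial.eval_C]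
      refine IsUnit.of_mul_eq_one (π (2 * E - 1)) ?_
      rw [← map_mul]
      have e1 : (((2 : ℕ) : S) * E ^ (2 - 1) - 1) * (2 * E - 1) = 4 * (E * E) - 4 * E + 1 := by
        push_cast; ring
      rw [e1, map_add, map_sub, map_mul π 4 (E * E), map_mul π E E, map_mul π 4 E, hE]
      simp)
  have ha' : a = 0 ∨ a = 1 := by
    have h1 : a ^ 2 - a = 0 := by simpa using ha
    have h2 : a * (a - 1) = 0 := by rw [← h1]; ring
    rcases mul_eq_zero.1 h2 with h | h
    · exact Or.inl h
    · exact Or.inr (sub_eq_zero.1 h)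
  have haE' : T ∣ a - E := Ideal.mem_span_singleton.1 haE
  rcases ha' with rfl | rfl
  · right
    have hE0 : π E = 0 := by rw [hπ]; simpa using haE'
    have hx0 : π (x ^ m) = 0 := by
      rw [map_pow, ← hm2]
      have : π x ^ (m + m) * π y ^ m = π x ^ m * π E := by
        simp only [E, map_mul, map_pow]; ring
      rw [this, hE0, mul_zero]
    have h1 := hunit _ ((hπ _).1 hx0)
    have h2 : (1 - x) ∣ 1 - x ^ m := by simpa using sub_dvd_pow_sub_pow 1 x m
    exact isUnit_of_dvd_unit h2 h1
  · left
    have h1 := hunit _ haE'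
    rw [sub_sub_cancel] at h1
    refine isUnit_of_dvd_unit ?_ h1
    exact (dvd_pow_self x (by omega)).mul_right _

lemma cdv_of_complete {S : Type*} [CommRing S] [IsDomain S] [IsDiscreteValuationRing S] {T : S}
    (hT0 : T ≠ 0) (hTu : ¬ IsUnit T) (hc : SeqComplete T) (h0 : ∀ x, (∀ n, T ^ n ∣ x) → x = 0) :
    ∃ (ϖ : S) (v : ℕ), CDV S ϖ ∧ Associated T (ϖ ^ v) ∧ ∀ x ∈ maximalIdeal S, ϖ ∣ x := by
  obtain ⟨ϖ, hϖ⟩ := IsDiscreteValuationRing.exists_irreducible S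
  obtain ⟨v, hv⟩ := IsDiscreteValuationRing.associated_pow_irreducible hT0 hϖ
  have hmax : ∀ x ∈ maximalIdeal S, ϖ ∣ x := by
    intro x hx
    rw [hϖ.maximalIdeal_eq] at hx
    exact Ideal.mem_span_singleton.1 hx
  have hv1 : 1 ≤ v := by
    rcases Nat.eq_zero_or_pos v with rfl | h
    · rw [pow_zero, associated_one_iff_isUnit] at hv
      exact (hTu hv).elim
    · exact h
  have hpow : ∀ n, Associated (T ^ n) (ϖ ^ (v * n)) := fun n => by
    rw [pow_mul]; exact hv.pow_pow
  refine ⟨ϖ, v, ⟨hϖ.ne_zero, hϖ.not_isUnit, ?_, ?_, ?_⟩, hv, hmax⟩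
  · intro y
    by_cases hy : IsUnit y
    · exact Or.inr hy
    · exact Or.inl (hmax y ((mem_maximalIdeal y).2 hy))
  · intro x hx
    exact h0 x fun n => (hpow n).dvd.trans (hx _)
  · intro u hu
    obtain ⟨L, hL⟩ := hc (fun n => u (v * n)) (fun n =>
      (hpow n).dvd.trans (cauchy_dvd hu (v * n) (v * (n + 1)) (by gcongr; omega)))
    refine ⟨L, fun n => ?_⟩
    have hle : n ≤ v * n := Nat.le_mul_of_pos_left _ hv1
    have h1 : ϖ ^ n ∣ L - u (v * n) := (pow_dvd_pow _ hle).trans ((hpow n).symm.dvd.trans (hL n))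
    have h2 := cauchy_dvd hu n (v * n) hle
    have := dvd_add h1 h2
    simpa using this

/-- **Theorem (dimension one).** A complete Noetherian local domain of Krull dimension `1` has
the linear approximation property: every finite system of polynomials over it admits an Artin
bound that is bounded above by a linear function of `n`. -/
theorem lap_of_dimension_one
    (R : Type*) [CommRing R] [IsDomain R] [IsNoetherianRing R] [IsLocalRing R]
    [IsAdicComplete (maximalIdeal R) R]
    (hdim : ringKrullDim R = 1)
    (N r : ℕ) (f : Fin r → MvPolynomial (Fin N) R) :
    ∃ (β : ℕ → ℕ) (c e : ℕ), IsArtinBound (maximalIdeal R) f β ∧ ∀ n, β n ≤ c * n + e := by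
  obtain ⟨hnf, hradm⟩ := ringKrullDim_eq_one_iff_of_isLocalRing_isDomain.1 hdim
  have hbot : maximalIdeal R ≠ ⊥ := fun h => hnf (IsLocalRing.isField_iff_maximalIdeal_eq.2 h)
  obtain ⟨t, htm, ht0⟩ := Submodule.exists_mem_ne_zero_of_ne_bot hbot
  have htu : ¬ IsUnit t := (mem_maximalIdeal t).1 htm
  have hrad : ∀ s : R, s ≠ 0 → ∃ e, s ∣ t ^ e := by
    intro s hs
    obtain ⟨e, he⟩ := hradm s hs htm
    exact ⟨e, Ideal.mem_span_singleton.1 he⟩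
  obtain ⟨k, hk⟩ := Ideal.exists_pow_le_of_le_radical_of_fg (hradm t ht0)
    (IsNoetherian.noetherian (maximalIdeal R))
  have hcomp : SeqComplete t := seqComplete_of_adic htm hk
  have hKD : Ring.KrullDimLE 1 R := by
    rw [Ring.krullDimLE_iff, hdim]; rfl
  have hD1 : Ring.DimensionLEOne R :=
    ⟨fun {p} h1 h2 => Ring.krullDimLE_one_iff_of_noZeroDivisors.1 hKD p h1 h2⟩
  let K := FractionRing R
  let S := integralClosure R K
  have : FaithfulSMul R S := inferInstance
  have hinj := FaithfulSMul.algebraMap_injective R S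
  have hfrac : ∀ z : S, ∃ s : R, s ≠ 0 ∧ ∃ r, algebraMap R S s * z = algebraMap R S r := by
    intro z
    obtain ⟨u, w, hw, huw⟩ := IsFractionRing.div_surjective (A := R) (z : K)
    refine ⟨w, nonZeroDivisors.ne_zero hw, u, Subtype.ext ?_⟩
    change algebraMap R K w * (z : K) = algebraMap R K u
    have hw0 : algebraMap R K w ≠ 0 := by
      rw [Ne, map_eq_zero_iff _ (IsFractionRing.injective R K)]; exact nonZeroDivisors.ne_zero hw
    rw [← huw, mul_div_cancel₀ _ hw0]
  obtain ⟨e, he⟩ := cond_exists (S := S) htu ht0 hrad hcomp hfrac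
  have hcompS := cond_complete ht0 hcomp he
  have hausS : ∀ x : S, (∀ n, algebraMap R S t ^ n ∣ x) → x = 0 := cond_haus htu ht0 hrad
  have hnoe : IsNoetherianRing S := cond_noeth ht0 he
  have hT0 : algebraMap R S t ≠ 0 := by rwa [Ne, map_eq_zero_iff _ hinj]
  have hTu : ¬ IsUnit (algebraMap R S t) := fun h => htu ((isUnit_map_iff (algebraMap R S) t).1 h)
  have hadic := adic_of_seqComplete hcompS hausS
  have hDS : Ring.DimensionLEOne S := Ring.DimensionLEOne.integralClosure R K
  have hloc : IsLocalRing S := local_of_complete hT0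
  have hIC : IsIntegrallyClosed S := integralClosure.isIntegrallyClosedOfFiniteExtension K
  have hnfS : ¬ IsField S := by
    intro h
    obtain ⟨y, hy⟩ := h.mul_inv_cancel hT0
    exact hTu (IsUnit.of_mul_eq_one _ hy)
  have hded : IsDedekindDomain S := { }
  have hdvr : IsDiscreteValuationRing S := ((IsDiscreteValuationRing.TFAE S hnfS).out 0 2).2 hded
  obtain ⟨ϖ, v, hcdv, hv, hmax⟩ := cdv_of_complete hT0 hTu hcompS hausS
  let F : Fin r → MvPolynomial (Fin N) S := fun i => MvPolynomial.map (algebraMap R S) (f i)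
  obtain ⟨c, d, H⟩ := greenberg hcdv (Ideal.span (Set.range F))
  refine ⟨fun n => c * (v * (n + e)) + d, c * v, c * v * e + d, ?_, fun n => le_of_eq (by ring)⟩
  intro n a ha
  have hev : ∀ i (x : Fin N → R), eval (fun j => algebraMap R S (x j)) (F i) =
      algebraMap R S (eval x (f i)) := by
    intro i x
    simp only [F]
    rw [MvPolynomial.eval_map]
    exact (MvPolynomial.eval₂_comp_left (algebraMap R S) (RingHom.id R) x (f i)).symm
  have hmR : ∀ m z, z ∈ maximalIdeal R ^ m → ϖ ^ m ∣ algebraMap R S z := by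
    intro m z hz
    have h1 : maximalIdeal R ^ m ≤ Ideal.comap (algebraMap R S) (Ideal.span {ϖ} ^ m) := by
      refine le_trans (Ideal.pow_right_mono ?_ m) (Ideal.le_comap_pow _ m)
      intro z hz
      refine Ideal.mem_comap.2 (Ideal.mem_span_singleton.2 (hmax _ ?_))
      rw [mem_maximalIdeal, mem_nonunits_iff, isUnit_map_iff]
      exact (mem_maximalIdeal z).1 hz
    have h2 := h1 hz
    rw [Ideal.mem_comap, Ideal.span_singleton_pow] at h2
    exact Ideal.mem_span_singleton.1 h2
  obtain ⟨b, hb, hab⟩ := H (v * (n + e)) (fun j => algebraMap R S (a j)) (by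
    intro g hg
    induction hg using Submodule.span_induction with
    | mem g hg =>
      obtain ⟨i, rfl⟩ := hg
      rw [hev]
      exact hmR _ _ (ha i)
    | zero => simp
    | add x y _ _ hx hy => rw [map_add]; exact dvd_add hx hy
    | smul x y _ hy => rw [smul_eq_mul, map_mul]; exact hy.mul_left _)
  have hdiff : ∀ j, ∃ q : R, algebraMap R S (a j) - b j = algebraMap R S (t ^ n * q) := by
    intro j
    have h1 : algebraMap R S t ^ (n + e) ∣ algebraMap R S (a j) - b j := by
      refine Dvd.dvd.trans ?_ (hab j)
      rw [pow_mul]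
      exact hv.pow_pow.dvd
    obtain ⟨y, hy⟩ := h1
    obtain ⟨q, hq⟩ := he y
    refine ⟨q, ?_⟩
    rw [hy, map_mul, ← hq, map_pow]; ring
  choose q hq using hdiff
  have hbq : b = fun j => algebraMap R S (a j - t ^ n * q j) := by
    funext j
    rw [map_sub, ← hq]; ring
  refine ⟨fun j => a j - t ^ n * q j, fun i => hinj ?_, fun j => ?_⟩
  · rw [← hev, ← hbq, map_zero]
    exact hb _ (Ideal.subset_span ⟨i, rfl⟩)
  · rw [sub_sub_cancel]
    exact Ideal.mul_mem_right _ _ (Ideal.pow_mem_pow htm n)
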